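/- Let S be a measurable space, D_pair a probability measure on S × S, and C : ℝ^d × S → ℝ a jointly measurable family of confidence estimators. Fix an integer m ≥ 2, δ' ∈ (0,1), γ > 0, and a probability measure P on ℝ^d (the prior, chosen independently of the data). Then, with probability at least 1 − δ' over an i.i.d. sample of m pairs (s_1, s'_1), …, (s_m, s'_m) drawn from D_pair, the following holds simultaneously for every θ ∈ ℝ^d and every probability distribution of a random perturbation u on ℝ^d satisfying P_u( sup_{s ∈ S} |C(θ + u, s) − C(θ, s)| < γ/4 ) ≥ 1/2: RK(θ) ≤ R̂K_γ(θ) + sqrt( (KL(law(θ + u)‖P) + ln(3√m/δ')) / (m − 1) ). -/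

import Mathlib

open MeasureTheory
open scoped ENNReal NNReal

/- Kullback–Leibler divergence (natural log), `∞` when `Q` is not absolutely
continuous w.r.t. `P` or when the log-density is not integrable. -/
open Classical in
noncomputable def KL {Ω : Type*} [MeasurableSpace Ω] (Q P : Measure Ω) : ℝ≥0∞ :=
  if Q ≪ P ∧ Integrable (fun ω => Real.log (Q.rnDeriv P ω).toReal) Q then
    ENNReal.ofReal (∫ ω, Real.log (Q.rnDeriv P ω).toReal ∂Q)
  else ⊤

section PACBayes

open ProbabilityTheory

/-- The gap between the probability of `A` and its empirical frequency on a sample. -/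
noncomputable def empiricalGap {Z : Type*} [MeasurableSpace Z] (D : Measure Z) (A : Set Z)
    {m : ℕ} (zs : Fin m → Z) : ℝ :=
  D.real A - (m : ℝ)⁻¹ * ∑ i, A.indicator (fun _ => (1 : ℝ)) (zs i)

lemma abs_empiricalGap_le_one {Z : Type*} [MeasurableSpace Z] (D : Measure Z)
    [IsProbabilityMeasure D] (A : Set Z) {m : ℕ} (zs : Fin m → Z) :
    |empiricalGap D A zs| ≤ 1 := by
  have h0 : 0 ≤ ∑ i, A.indicator (fun _ => (1 : ℝ)) (zs i) :=
    Finset.sum_nonneg fun i _ => Set.indicator_nonneg (fun _ _ => zero_le_one) _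
  have h1 : ∑ i, A.indicator (fun _ => (1 : ℝ)) (zs i) ≤ m := by
    calc ∑ i, A.indicator (fun _ => (1 : ℝ)) (zs i) ≤ ∑ _i : Fin m, (1 : ℝ) :=
          Finset.sum_le_sum fun i _ => Set.indicator_le_self' (fun _ _ => zero_le_one) _
      _ = m := by simp
  have h2 : (m : ℝ)⁻¹ * ∑ i, A.indicator (fun _ => (1 : ℝ)) (zs i) ≤ 1 := by
    rw [inv_mul_eq_div]
    exact div_le_one_of_le₀ h1 (Nat.cast_nonneg m)
  have h3 : 0 ≤ (m : ℝ)⁻¹ * ∑ i, A.indicator (fun _ => (1 : ℝ)) (zs i) := by positivity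
  have h4 : D.real A ≤ 1 := measureReal_le_one
  have h5 : 0 ≤ D.real A := measureReal_nonneg
  rw [empiricalGap, abs_le]
  constructor <;> linarith

lemma measurable_empiricalGap {Z : Type*} [MeasurableSpace Z] (D : Measure Z) {A : Set Z}
    (hA : MeasurableSet A) (m : ℕ) :
    Measurable fun zs : Fin m → Z => empiricalGap D A zs := by
  unfold empiricalGap
  refine Measurable.const_sub (Measurable.const_mul ?_ _) _
  exact Finset.measurable_sum _ fun i _ =>
    (measurable_const.indicator hA).comp (measurable_pi_apply i)

lemma measurable_empiricalGap_prod {W Z : Type*} [MeasurableSpace W] [MeasurableSpace Z]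
    (D : Measure Z) [IsProbabilityMeasure D] {E : Set (W × Z)} (hE : MeasurableSet E) (m : ℕ) :
    Measurable fun p : (Fin m → Z) × W => empiricalGap D (Prod.mk p.2 ⁻¹' E) p.1 := by
  unfold empiricalGap
  refine Measurable.sub ?_ (Measurable.const_mul ?_ _)
  · exact ((measurable_measure_prodMk_left hE).comp measurable_snd).ennreal_toReal
  · refine Finset.measurable_sum _ fun i _ => ?_
    have : Measurable fun p : (Fin m → Z) × W => (p.2, p.1 i) := by fun_prop
    exact (measurable_const.indicator hE).comp this

/-- Hoeffding's bound for the moment generating function of the empirical gap. -/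
lemma lintegral_exp_mul_empiricalGap_le {Z : Type*} [MeasurableSpace Z] (D : Measure Z)
    [IsProbabilityMeasure D] {A : Set Z} (hA : MeasurableSet A) {m : ℕ} (hm : m ≠ 0) (t : ℝ) :
    ∫⁻ zs, ENNReal.ofReal (Real.exp (t * empiricalGap D A zs)) ∂(Measure.pi fun _ : Fin m => D)
      ≤ ENNReal.ofReal (Real.exp (t ^ 2 / (8 * m))) := by
  have hm0 : (m : ℝ) ≠ 0 := Nat.cast_ne_zero.2 hm
  set X : Z → ℝ := A.indicator (fun _ => (1 : ℝ)) with hX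
  have hXm : Measurable X := measurable_const.indicator hA
  have hmean : ∫ z, X z ∂D = D.real A := by simp [hX, integral_indicator hA]
  have hsub := hasSubgaussianMGF_of_mem_Icc (μ := D) (X := X) (a := 0) (b := 1) hXm.aemeasurable
    (Filter.Eventually.of_forall fun z =>
      ⟨Set.indicator_nonneg (fun _ _ => zero_le_one) z,
        Set.indicator_le_self' (fun _ _ => zero_le_one) z⟩)
  rw [hmean] at hsub
  set g : Z → ℝ := fun z => Real.exp (-t / m * (X z - D.real A)) with hg
  have hprod : ∀ zs : Fin m → Z, Real.exp (t * empiricalGap D A zs) = ∏ i, g (zs i) := by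
    intro zs
    rw [hg, ← Real.exp_sum, ← Finset.mul_sum, Finset.sum_sub_distrib, empiricalGap]
    congr 1
    simp only [Finset.sum_const, Finset.card_univ, Fintype.card_fin, nsmul_eq_mul]
    field_simp
    ring
  have hgi : Integrable g D := hsub.integrable_exp_mul (-t / m)
  have hgle : ∫ z, g z ∂D ≤ Real.exp ((t / m) ^ 2 / 8) := by
    refine (hsub.mgf_le (-t / m)).trans_eq ?_
    congr 1
    push_cast
    norm_num
    ring
  simp_rw [hprod]
  rw [← ofReal_integral_eq_lintegral_ofReal (Integrable.fintype_prod fun _ => hgi)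
    (Filter.Eventually.of_forall fun zs => Finset.prod_nonneg fun i _ => (Real.exp_pos _).le),
    integral_fintype_prod_eq_pow]
  refine ENNReal.ofReal_le_ofReal ?_
  calc (∫ z, g z ∂D) ^ Fintype.card (Fin m) ≤ Real.exp ((t / m) ^ 2 / 8) ^ m := by
        rw [Fintype.card_fin]
        exact pow_le_pow_left₀ (integral_nonneg fun z => (Real.exp_pos _).le) hgle m
    _ = Real.exp (t ^ 2 / (8 * m)) := by
        rw [← Real.exp_nat_mul]
        congr 1
        field_simp

lemma lintegral_exp_mul_gaussianReal (t : ℝ) :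
    ∫⁻ x, ENNReal.ofReal (Real.exp (t * x)) ∂(gaussianReal 0 1)
      = ENNReal.ofReal (Real.exp (t ^ 2 / 2)) := by
  rw [← ofReal_integral_eq_lintegral_ofReal (integrable_exp_mul_gaussianReal t)
    (Filter.Eventually.of_forall fun _ => (Real.exp_pos _).le)]
  have := congrFun (mgf_id_gaussianReal (μ := 0) (v := 1)) t
  simp only [mgf, id_eq] at this
  rw [this]
  simp

lemma lintegral_exp_mul_sq_gaussianReal {m : ℕ} (hm : m ≠ 0) :
    ∫⁻ x, ENNReal.ofReal (Real.exp (((m : ℝ) - 1) / (2 * m) * x ^ 2)) ∂(gaussianReal 0 1)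
      = ENNReal.ofReal (Real.sqrt m) := by
  have hm0 : (0 : ℝ) < m := Nat.cast_pos.2 (Nat.pos_of_ne_zero hm)
  rw [gaussianReal_of_var_ne_zero _ one_ne_zero,
    lintegral_withDensity_eq_lintegral_mul _ (measurable_gaussianPDF 0 1) (by fun_prop)]
  have h : ∀ x : ℝ, (gaussianPDF 0 1 * fun x : ℝ =>
      ENNReal.ofReal (Real.exp (((m : ℝ) - 1) / (2 * m) * x ^ 2))) x
      = ENNReal.ofReal ((Real.sqrt (2 * Real.pi))⁻¹ * Real.exp (-(1 / (2 * m)) * x ^ 2)) := by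
    intro x
    rw [Pi.mul_apply, gaussianPDF, ← ENNReal.ofReal_mul (gaussianPDFReal_nonneg _ _ _),
      gaussianPDFReal, mul_assoc, ← Real.exp_add]
    congr 3
    · simp
    · push_cast
      field_simp
      ring
  simp_rw [h]
  rw [← ofReal_integral_eq_lintegral_ofReal
    ((integrable_exp_neg_mul_sq (by positivity)).const_mul _)
    (Filter.Eventually.of_forall fun _ => by positivity),
    integral_const_mul, integral_gaussian]
  congr 1
  rw [inv_mul_eq_div, ← Real.sqrt_div (by positivity)]
  congr 1
  field_simp

/-- The exponential second moment of the empirical gap is at most `√m`. -/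
lemma lintegral_exp_mul_sq_empiricalGap_le {Z : Type*} [MeasurableSpace Z] (D : Measure Z)
    [IsProbabilityMeasure D] {A : Set Z} (hA : MeasurableSet A) {m : ℕ} (hm : m ≠ 0) :
    ∫⁻ zs, ENNReal.ofReal (Real.exp (2 * ((m : ℝ) - 1) * empiricalGap D A zs ^ 2))
        ∂(Measure.pi fun _ : Fin m => D) ≤ ENNReal.ofReal (Real.sqrt m) := by
  have hm1 : (0 : ℝ) ≤ m - 1 := by
    have : (1 : ℝ) ≤ m := Nat.one_le_cast.2 (Nat.one_le_iff_ne_zero.2 hm)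
    linarith
  have hgap := measurable_empiricalGap D hA m
  calc ∫⁻ zs, ENNReal.ofReal (Real.exp (2 * ((m : ℝ) - 1) * empiricalGap D A zs ^ 2))
        ∂(Measure.pi fun _ : Fin m => D)
      = ∫⁻ zs, ∫⁻ x, ENNReal.ofReal
          (Real.exp (2 * Real.sqrt (m - 1) * x * empiricalGap D A zs)) ∂(gaussianReal 0 1)
          ∂(Measure.pi fun _ : Fin m => D) := by
        refine lintegral_congr fun zs => ?_
        have := lintegral_exp_mul_gaussianReal (2 * Real.sqrt (m - 1) * empiricalGap D A zs)
        rw [mul_pow, mul_pow, Real.sq_sqrt hm1] at this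
        rw [show 2 * ((m : ℝ) - 1) * empiricalGap D A zs ^ 2
          = 2 ^ 2 * ((m : ℝ) - 1) * empiricalGap D A zs ^ 2 / 2 by ring, ← this]
        refine lintegral_congr fun x => ?_
        ring_nf
    _ = ∫⁻ x, ∫⁻ zs, ENNReal.ofReal
          (Real.exp (2 * Real.sqrt (m - 1) * x * empiricalGap D A zs))
          ∂(Measure.pi fun _ : Fin m => D) ∂(gaussianReal 0 1) := by
        refine lintegral_lintegral_swap (Measurable.aemeasurable ?_)
        have := hgap.comp (measurable_fst : Measurable fun p : (Fin m → Z) × ℝ => p.1)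
        simp only [Function.comp_def] at this
        simp only [Function.uncurry_def]
        fun_prop
    _ ≤ ∫⁻ x, ENNReal.ofReal (Real.exp (((m : ℝ) - 1) / (2 * m) * x ^ 2)) ∂(gaussianReal 0 1) := by
        refine lintegral_mono fun x => (lintegral_exp_mul_empiricalGap_le D hA hm _).trans_eq ?_
        rw [mul_pow, mul_pow, Real.sq_sqrt hm1]
        congr 2
        field_simp
        ring
    _ = ENNReal.ofReal (Real.sqrt m) := lintegral_exp_mul_sq_gaussianReal hm

/-- The change of measure inequality (one half of the Donsker–Varadhan formula). -/
lemma integral_le_integral_log_rnDeriv_add_log {W : Type*} [MeasurableSpace W]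
    (Q P : Measure W) [IsProbabilityMeasure Q] [IsProbabilityMeasure P] (hQP : Q ≪ P)
    (hint : Integrable (fun w => Real.log (Q.rnDeriv P w).toReal) Q)
    {φ : W → ℝ} (hφ : Measurable φ) (hφQ : Integrable φ Q) {K : ℝ} (hK : 0 < K)
    (hφK : ∫⁻ w, ENNReal.ofReal (Real.exp (φ w)) ∂P ≤ ENNReal.ofReal K) :
    ∫ w, φ w ∂Q ≤ ∫ w, Real.log (Q.rnDeriv P w).toReal ∂Q + Real.log K := by
  set h : W → ℝ := fun w => Real.exp (φ w) * ((Q.rnDeriv P w).toReal)⁻¹ with hh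
  have hhm : Measurable h := by fun_prop
  have hhnn : ∀ w, 0 ≤ h w := fun w => by positivity
  have hlin : ∫⁻ w, ENNReal.ofReal (h w) ∂Q ≤ ENNReal.ofReal K := by
    rw [← lintegral_rnDeriv_mul hQP (by fun_prop)]
    refine le_trans (lintegral_mono_ae ?_) hφK
    filter_upwards [Q.rnDeriv_lt_top P] with w hw
    rw [← ENNReal.ofReal_toReal hw.ne, ← ENNReal.ofReal_mul ENNReal.toReal_nonneg]
    refine ENNReal.ofReal_le_ofReal ?_
    rw [hh]
    rcases eq_or_ne (Q.rnDeriv P w).toReal 0 with h0 | h0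
    · simp [h0, (Real.exp_pos _).le]
    · dsimp only
      rw [mul_comm, mul_assoc, inv_mul_cancel₀ h0, mul_one]
  have hhi : Integrable h Q := by
    refine ⟨hhm.aestronglyMeasurable, ?_⟩
    rw [hasFiniteIntegral_iff_ofReal (Filter.Eventually.of_forall hhnn)]
    exact hlin.trans_lt ENNReal.ofReal_lt_top
  have hhle : ∫ w, h w ∂Q ≤ K := by
    rw [← ofReal_integral_eq_lintegral_ofReal hhi (Filter.Eventually.of_forall hhnn)] at hlin
    exact (ENNReal.ofReal_le_ofReal_iff hK.le).1 hlin
  have hpt : ∀ᵐ w ∂Q, φ w - Real.log (Q.rnDeriv P w).toReal - Real.log K ≤ h w * K⁻¹ - 1 := by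
    filter_upwards [Measure.rnDeriv_pos hQP, hQP.ae_le (Q.rnDeriv_lt_top P)] with w hpos hlt
    have hr : 0 < (Q.rnDeriv P w).toReal := ENNReal.toReal_pos hpos.ne' hlt.ne
    have := Real.add_one_le_exp (φ w - Real.log (Q.rnDeriv P w).toReal - Real.log K)
    rw [Real.exp_sub, Real.exp_sub, Real.exp_log hr, Real.exp_log hK] at this
    simp only [hh, ← div_eq_mul_inv]
    linarith
  have hmono := integral_mono_ae ((hφQ.sub hint).sub (integrable_const (Real.log K)))
    ((hhi.mul_const K⁻¹).sub (integrable_const (1 : ℝ))) hpt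
  rw [integral_sub' (hφQ.sub hint) (integrable_const _), integral_sub' hφQ hint,
    integral_sub' (hhi.mul_const _) (integrable_const _), integral_mul_const] at hmono
  simp only [integral_const, probReal_univ, smul_eq_mul, one_mul] at hmono
  have : (∫ w, h w ∂Q) * K⁻¹ ≤ 1 := by
    rw [← div_eq_mul_inv]
    exact (div_le_one hK).2 hhle
  linarith

/-- With high probability over the sample, the exponential second moment of the empirical gap
under the prior is controlled. -/
lemma ofReal_one_sub_le_measure_lintegral_empiricalGap {W Z : Type*} [MeasurableSpace W]
    [MeasurableSpace Z] (P : Measure W) [IsProbabilityMeasure P] (D : Measure Z)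
    [IsProbabilityMeasure D] {E : Set (W × Z)} (hE : MeasurableSet E) {m : ℕ} (hm : m ≠ 0)
    {δ : ℝ} (hδ : 0 < δ) :
    ENNReal.ofReal (1 - δ) ≤ (Measure.pi fun _ : Fin m => D)
      {zs | ∫⁻ w, ENNReal.ofReal (Real.exp
        (2 * ((m : ℝ) - 1) * empiricalGap D (Prod.mk w ⁻¹' E) zs ^ 2)) ∂P
          ≤ ENNReal.ofReal (Real.sqrt m / δ)} := by
  set F : (Fin m → Z) → ℝ≥0∞ := fun zs => ∫⁻ w, ENNReal.ofReal (Real.exp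
    (2 * ((m : ℝ) - 1) * empiricalGap D (Prod.mk w ⁻¹' E) zs ^ 2)) ∂P with hF
  have hgap := measurable_empiricalGap_prod D hE m
  have hFm : Measurable F := by
    refine Measurable.lintegral_prod_right ?_
    simp only [Function.uncurry_def]
    fun_prop
  have hsqrt : 0 < Real.sqrt m :=
    Real.sqrt_pos.2 (Nat.cast_pos.2 (Nat.pos_of_ne_zero hm))
  have hFint : ∫⁻ zs, F zs ∂(Measure.pi fun _ : Fin m => D) ≤ ENNReal.ofReal (Real.sqrt m) := by
    rw [hF, lintegral_lintegral_swap (Measurable.aemeasurable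
      (by simp only [Function.uncurry_def]; fun_prop))]
    calc _ ≤ ∫⁻ _w, ENNReal.ofReal (Real.sqrt m) ∂P := lintegral_mono fun w =>
          lintegral_exp_mul_sq_empiricalGap_le D (measurable_prodMk_left hE) hm
      _ = _ := by simp
  have hbad : (Measure.pi fun _ : Fin m => D) {zs | ENNReal.ofReal (Real.sqrt m / δ) ≤ F zs}
      ≤ ENNReal.ofReal δ := by
    refine (meas_ge_le_lintegral_div hFm.aemeasurable
      (ENNReal.ofReal_pos.2 (by positivity)).ne' ENNReal.ofReal_ne_top).trans ?_
    refine (ENNReal.div_le_div_right hFint _).trans_eq ?_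
    rw [← ENNReal.ofReal_div_of_pos (by positivity)]
    congr 1
    field_simp
  have hmeas : MeasurableSet {zs | F zs ≤ ENNReal.ofReal (Real.sqrt m / δ)} :=
    measurableSet_le hFm measurable_const
  have hcompl : (Measure.pi fun _ : Fin m => D) {zs | F zs ≤ ENNReal.ofReal (Real.sqrt m / δ)}ᶜ
      ≤ ENNReal.ofReal δ :=
    (measure_mono fun zs (hzs : ¬F zs ≤ _) => (not_le.1 hzs).le).trans hbad
  rw [ENNReal.ofReal_sub _ hδ.le, ENNReal.ofReal_one, tsub_le_iff_right,
    ← prob_add_prob_compl (μ := Measure.pi fun _ : Fin m => D) hmeas]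
  gcongr

end PACBayes

/-- Margin-based PAC-Bayesian ranking bound (Corollary 3.3): with probability at
least `1 - δ'` over an i.i.d. sample of `m` pairs from `D_pair`, simultaneously
for every `θ` and every random perturbation distribution `ν` that keeps the
confidence function within `γ/4` with probability at least `1/2`,
`RK(θ) ≤ R̂K_γ(θ) + √((KL(law(θ+u)‖P) + ln(3√m/δ')) / (m-1))`. -/
theorem stmt1 {S : Type*} [MeasurableSpace S]
    (Dpair : Measure (S × S)) [IsProbabilityMeasure Dpair]
    (d : ℕ) (C : (Fin d → ℝ) → S → ℝ)
    (hC : Measurable (Function.uncurry C))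
    (m : ℕ) (hm : 2 ≤ m) (δ' : ℝ) (hδ' : δ' ∈ Set.Ioo (0 : ℝ) 1)
    (γ : ℝ) (hγ : 0 < γ)
    (P : Measure (Fin d → ℝ)) [IsProbabilityMeasure P] :
    ENNReal.ofReal (1 - δ') ≤
      (Measure.pi fun _ : Fin m => Dpair)
        {ps : Fin m → S × S |
          ∀ θ : Fin d → ℝ, ∀ ν : Measure (Fin d → ℝ), IsProbabilityMeasure ν →
            1 / 2 ≤ ν {u | ∀ s : S, |C (θ + u) s - C θ s| < γ / 4} →
            Dpair {q : S × S | C θ q.1 < C θ q.2} ≤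
              ENNReal.ofReal ((m : ℝ)⁻¹ *
                (Set.ncard {i : Fin m | C θ (ps i).1 < C θ (ps i).2 + γ} : ℝ))
              + ((KL (Measure.map (fun u => θ + u) ν) P
                  + ENNReal.ofReal (Real.log (3 * Real.sqrt m / δ'))) /
                  ((m : ℝ≥0∞) - 1)) ^ ((1 : ℝ) / 2)} := by
  obtain ⟨hδ0, hδ1⟩ := hδ'
  have hm0 : m ≠ 0 := by omega
  have hm2 : (2 : ℝ) ≤ m := Nat.ofNat_le_cast.2 hm
  have hm1 : (0 : ℝ) < m - 1 := by linarith
  set E : Set ((Fin d → ℝ) × (S × S)) := {p | C p.1 p.2.1 < C p.1 p.2.2 + γ / 2} with hEdef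
  have hC1 : Measurable fun p : (Fin d → ℝ) × (S × S) => C p.1 p.2.1 :=
    hC.comp (by fun_prop : Measurable fun p : (Fin d → ℝ) × (S × S) => (p.1, p.2.1))
  have hC2 : Measurable fun p : (Fin d → ℝ) × (S × S) => C p.1 p.2.2 :=
    hC.comp (by fun_prop : Measurable fun p : (Fin d → ℝ) × (S × S) => (p.1, p.2.2))
  have hE : MeasurableSet E := measurableSet_lt hC1 (hC2.add_const _)
  refine (ofReal_one_sub_le_measure_lintegral_empiricalGap P Dpair hE hm0 hδ0).trans
    (measure_mono ?_)
  intro ps hps θ ν hν hpert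
  simp only [Set.mem_ofPred_eq] at hps
  set Q := Measure.map (fun u => θ + u) ν with hQdef
  have hshift : Measurable fun u : Fin d → ℝ => θ + u := by fun_prop
  have : IsProbabilityMeasure Q := Measure.isProbabilityMeasure_map hshift.aemeasurable
  have hden : (m : ℝ≥0∞) - 1 = ENNReal.ofReal (m - 1) := by
    rw [ENNReal.ofReal_sub _ zero_le_one, ENNReal.ofReal_one, ENNReal.ofReal_natCast]
  rw [hden]
  by_cases hKL : Q ≪ P ∧ Integrable (fun ω => Real.log (Q.rnDeriv P ω).toReal) Q
  swap
  · rw [KL, if_neg hKL, top_add, ENNReal.top_div_of_ne_top ENNReal.ofReal_ne_top,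
      ENNReal.top_rpow_of_pos (by norm_num), add_top]
    exact le_top
  rw [KL, if_pos hKL]
  set I := ∫ ω, Real.log (Q.rnDeriv P ω).toReal ∂Q
  set Rhat : ℝ := (m : ℝ)⁻¹ *
    (Set.ncard {i : Fin m | C θ (ps i).1 < C θ (ps i).2 + γ} : ℝ) with hRhat
  set R : ℝ := Dpair.real {q : S × S | C θ q.1 < C θ q.2} with hR
  have hRofReal : Dpair {q : S × S | C θ q.1 < C θ q.2} = ENNReal.ofReal R :=
    (ENNReal.ofReal_toReal (measure_ne_top _ _)).symm
  have hRhat0 : 0 ≤ Rhat := by positivity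
  rw [hRofReal]
  rcases le_total R Rhat with hle | hle
  · exact (ENNReal.ofReal_le_ofReal hle).trans le_self_add
  set G : (Fin d → ℝ) → ℝ := fun w => empiricalGap Dpair (Prod.mk w ⁻¹' E) ps with hG
  have hGm : Measurable G := (measurable_empiricalGap_prod Dpair hE m).comp
    (measurable_const.prodMk measurable_id : Measurable fun w : Fin d → ℝ => (ps, w))
  set φ : (Fin d → ℝ) → ℝ := fun w => 2 * ((m : ℝ) - 1) * G w ^ 2 with hφ
  have hφm : Measurable φ := by fun_prop
  have hφ0 : ∀ w, 0 ≤ φ w := fun w => by positivity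
  have hφQ : Integrable φ Q := by
    refine Integrable.of_bound hφm.aestronglyMeasurable (2 * ((m : ℝ) - 1))
      (Filter.Eventually.of_forall fun w => ?_)
    rw [Real.norm_of_nonneg (hφ0 w)]
    have : G w ^ 2 ≤ 1 := (sq_le_one_iff_abs_le_one _).2 (abs_empiricalGap_le_one _ _ _)
    exact mul_le_of_le_one_right (by positivity) this
  have hsqrt1 : 1 ≤ Real.sqrt m := Real.one_le_sqrt.2 (by linarith)
  have hDV := integral_le_integral_log_rnDeriv_add_log Q P hKL.1 hKL.2 hφm hφQ
    (K := Real.sqrt m / δ') (by positivity) hps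
  -- The gap is at least `R - Rhat` at every admissible perturbation of `θ`.
  have hclose : {u | ∀ s : S, |C (θ + u) s - C θ s| < γ / 4} ⊆
      (fun u => θ + u) ⁻¹' {w | R - Rhat ≤ G w} := by
    intro u hu
    have hL : R ≤ Dpair.real (Prod.mk (θ + u) ⁻¹' E) := by
      refine measureReal_mono fun q hq => ?_
      have h1 := abs_lt.1 (hu q.1)
      have h2 := abs_lt.1 (hu q.2)
      simp only [Set.mem_ofPred_eq, Set.mem_preimage, hEdef] at hq ⊢
      linarith
    have hemp : ∑ i, (Prod.mk (θ + u) ⁻¹' E).indicator (fun _ => (1 : ℝ)) (ps i) ≤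
        (Set.ncard {i : Fin m | C θ (ps i).1 < C θ (ps i).2 + γ} : ℝ) := by
      classical
      rw [Set.ncard_eq_toFinset_card', Finset.card_eq_sum_ones, Nat.cast_sum, Set.toFinset_ofPred,
        Finset.sum_filter]
      refine Finset.sum_le_sum fun i _ => ?_
      have h1 := abs_lt.1 (hu (ps i).1)
      have h2 := abs_lt.1 (hu (ps i).2)
      simp only [Set.indicator_apply, Set.mem_preimage, hEdef, Set.mem_ofPred_eq]
      split_ifs with ha hb
      · simp
      · exact absurd (by linarith) hb
      · simp
      · exact le_rfl
    have := mul_le_mul_of_nonneg_left hemp (by positivity : (0 : ℝ) ≤ (m : ℝ)⁻¹)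
    simp only [Set.mem_preimage, Set.mem_ofPred_eq, hG, empiricalGap]
    linarith
  have hBm : MeasurableSet {w | R - Rhat ≤ G w} := measurableSet_le measurable_const hGm
  have hQB : 1 / 2 ≤ Q.real {w | R - Rhat ≤ G w} := by
    have : 1 / 2 ≤ Q {w | R - Rhat ≤ G w} := by
      rw [hQdef, Measure.map_apply hshift hBm]
      exact hpert.trans (measure_mono hclose)
    have := ENNReal.toReal_mono (measure_ne_top _ _) this
    simpa [Measure.real] using this
  have hMarkov : (m - 1) * (R - Rhat) ^ 2 ≤ ∫ w, φ w ∂Q := by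
    have h := mul_meas_ge_le_integral_of_nonneg (Filter.Eventually.of_forall hφ0) hφQ
      (2 * (m - 1) * (R - Rhat) ^ 2)
    have hsub : Q.real {w | R - Rhat ≤ G w} ≤ Q.real {w | 2 * (m - 1) * (R - Rhat) ^ 2 ≤ φ w} := by
      refine measureReal_mono fun w hw => ?_
      simp only [Set.mem_ofPred_eq, hφ] at hw ⊢
      have := pow_le_pow_left₀ (sub_nonneg.2 hle) hw 2
      gcongr
    have := mul_le_mul_of_nonneg_left (hQB.trans hsub)
      (by positivity : 0 ≤ 2 * ((m : ℝ) - 1) * (R - Rhat) ^ 2)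
    linarith
  have hlog : Real.log (Real.sqrt m / δ') ≤ Real.log (3 * Real.sqrt m / δ') := by
    refine Real.log_le_log (by positivity) ?_
    gcongr
    linarith
  set L := Real.log (3 * Real.sqrt m / δ')
  have hIL : (m - 1) * (R - Rhat) ^ 2 ≤ I + L := by linarith
  have hsq : (R - Rhat) ^ 2 ≤ (I + L) / (m - 1) := by
    rw [le_div_iff₀ hm1]
    linarith
  have hfinal : ENNReal.ofReal (R - Rhat) ≤
      ((ENNReal.ofReal I + ENNReal.ofReal L) / ENNReal.ofReal (m - 1)) ^ ((1 : ℝ) / 2) := by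
    calc ENNReal.ofReal (R - Rhat) = ENNReal.ofReal ((R - Rhat) ^ 2) ^ ((1 : ℝ) / 2) := by
          rw [ENNReal.ofReal_rpow_of_nonneg (by positivity) (by norm_num), ← Real.sqrt_eq_rpow,
            Real.sqrt_sq (sub_nonneg.2 hle)]
      _ ≤ _ := by
          refine ENNReal.rpow_le_rpow ?_ (by norm_num)
          refine (ENNReal.ofReal_le_ofReal hsq).trans ?_
          rw [ENNReal.ofReal_div_of_pos hm1]
          exact ENNReal.div_le_div_right ENNReal.ofReal_add_le _
  calc ENNReal.ofReal R = ENNReal.ofReal Rhat + ENNReal.ofReal (R - Rhat) := by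
        rw [← ENNReal.ofReal_add hRhat0 (sub_nonneg.2 hle)]
        congr 1
        ring
    _ ≤ _ := by gcongr
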